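/- Let (X,T) be an invertible topological dynamical system, μ a T-ergodic Borel probability measure, and Q = (A_1, A_2) a two-set Borel partition of X with h_μ(Q,T) > 0. Then there exists an asymptotic pair (x_1, x_2) with x_1 ∈ A_1 and x_2 ∈ A_2. -/

import Mathlib

open MeasureTheory Filter Topology Set
open scoped symmDiff Classical ENNReal NNReal

section Defs

variable {X : Type*}

/-- The pair `(x, y)` is (positively) asymptotic for `T`. -/
def IsAsymptoticPair [PseudoMetricSpace X] (T : X → X) (x y : X) : Prop :=
  Tendsto (fun n : ℕ => dist (T^[n] x) (T^[n] y)) atTop (𝓝 0)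

/-- Shannon entropy of the finite measurable partition of `X` given by the fibers of a
map `p` into a finite type. -/
noncomputable def partEntropy [MeasurableSpace X] (μ : Measure X) {ι : Type*} [Fintype ι]
    (p : X → ι) : ℝ :=
  ∑ i : ι, Real.negMulLog (μ (p ⁻¹' {i})).toReal

/-- Conditional Shannon entropy `H(P | F)` of the finite partition given by the fibers
of `p` with respect to the sub-σ-algebra `F`:
`H(P|F) = ∑_{A ∈ P} ∫ -E(1_A|F) log E(1_A|F) dμ`. -/
noncomputable def condPartEntropy [MeasurableSpace X] (μ : Measure X)
    (F : MeasurableSpace X) {ι : Type*} [Fintype ι] (p : X → ι) : ℝ :=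
  ∑ i : ι, ∫ x, Real.negMulLog ((μ[(p ⁻¹' {i}).indicator (fun _ => (1 : ℝ)) | F]) x) ∂μ

/-- The σ-algebra `σ(P^-)` generated by the partitions `T^{-n}P`, `n ≥ 1`
(the "past" of the partition given by the fibers of `p`). -/
def partPast (T : X → X) {ι : Type*} (p : X → ι) : MeasurableSpace X :=
  ⨆ n : ℕ, MeasurableSpace.comap (fun x => p (T^[n + 1] x)) ⊤

/-- The σ-algebra `σ(P^T)` generated by the partitions `T^{-n}P`, `n ∈ ℤ`, where `S = T⁻¹`. -/
def partHull (T S : X → X) {ι : Type*} (p : X → ι) : MeasurableSpace X :=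
  ⨆ n : ℕ,
    MeasurableSpace.comap (fun x => p (T^[n] x)) ⊤ ⊔
      MeasurableSpace.comap (fun x => p (S^[n] x)) ⊤

/-- Kolmogorov–Sinai entropy of a finite partition: `h_μ(P, T) = H(P | P^-)`. -/
noncomputable def partKS [MeasurableSpace X] (μ : Measure X) (T : X → X) {ι : Type*}
    [Fintype ι] (p : X → ι) : ℝ :=
  condPartEntropy μ (partPast T p) p

/-- Kolmogorov–Sinai (measure-theoretic) entropy `h_μ(X, T)` of the system:
the supremum over all finite measurable partitions `P` of `h_μ(P, T)`. -/
noncomputable def ksEntropy [MeasurableSpace X] (μ : Measure X) (T : X → X) : ℝ≥0∞ :=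
  ⨆ (k : ℕ) (p : X → Fin k) (_ : Measurable p), ENNReal.ofReal (partKS μ T p)

/-- The Pinsker σ-algebra `Π_μ`: the σ-algebra generated by all finite measurable
partitions with zero Kolmogorov–Sinai entropy. -/
def pinskerAlg [MeasurableSpace X] (μ : Measure X) (T : X → X) : MeasurableSpace X :=
  ⨆ (k : ℕ) (p : X → Fin k) (_ : Measurable p) (_ : partKS μ T p = 0),
    MeasurableSpace.comap p ⊤

/-- Minimal cardinality of a subcover of `⋁_{i=0}^{n-1} T^{-i} C`, where `C` is a
finite cover of `X`. -/
noncomputable def coverNum (T : X → X) {k : ℕ} (C : Fin k → Set X) (n : ℕ) : ℕ :=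
  sInf {m : ℕ | ∃ f : Fin m → Fin n → Fin k,
    (⋃ j : Fin m, ⋂ i : Fin n, T^[(i : ℕ)] ⁻¹' C (f j i)) = Set.univ}

/-- Topological entropy of a finite cover `C`:
`h(C, T) = inf_n (1/n) log N(⋁_{i=0}^{n-1} T^{-i} C) = lim_n (1/n) log N(...)`. -/
noncomputable def coverEntropyOf (T : X → X) {k : ℕ} (C : Fin k → Set X) : ℝ :=
  ⨅ n : ℕ, Real.log (coverNum T C (n + 1)) / (n + 1)

/-- `(x, y)` is a topological entropy pair: `x ≠ y` and every two-set open cover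
`{Uᶜ, Vᶜ}`, where `U` and `V` are disjoint closed neighbourhoods of `x` and `y`,
has positive topological entropy. -/
def IsEntropyPair [TopologicalSpace X] (T : X → X) (x y : X) : Prop :=
  x ≠ y ∧ ∀ U V : Set X, IsClosed U → IsClosed V → U ∈ 𝓝 x → V ∈ 𝓝 y → Disjoint U V →
    0 < coverEntropyOf T ![Uᶜ, Vᶜ]

/-- `(x, y)` is an entropy pair for the invariant measure `μ`: `x ≠ y` and every two-set
Borel partition `(A, Aᶜ)` with `x ∈ interior A` and `y ∈ interior Aᶜ` has positive
entropy with respect to `T` and `μ`. -/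
def IsMuEntropyPair [TopologicalSpace X] [MeasurableSpace X] (T : X → X) (μ : Measure X)
    (x y : X) : Prop :=
  x ≠ y ∧ ∀ A : Set X, MeasurableSet A → x ∈ interior A → y ∈ interior Aᶜ →
    0 < partKS μ T (fun z => if z ∈ A then (0 : Fin 2) else 1)

/-- `ν` is the relatively independent square `μ ⊠_G μ` of `μ` over the sub-σ-algebra `G`:
it is determined by `ν(A × B) = ∫ E(1_A|G) · E(1_B|G) dμ` for all Borel sets `A`, `B`. -/
def IsCondSquare (G : MeasurableSpace X) [m0 : MeasurableSpace X] (μ : Measure X)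
    (ν : Measure (X × X)) : Prop :=
  ∀ A B : Set X, MeasurableSet[m0] A → MeasurableSet[m0] B →
    ν (A ×ˢ B) = ENNReal.ofReal
      (∫ x, (μ[A.indicator (fun _ => (1 : ℝ)) | G]) x *
            (μ[B.indicator (fun _ => (1 : ℝ)) | G]) x ∂μ)

/-- The σ-algebra `m₁` is contained in `m₂` modulo `μ`-null sets. -/
def SubModNull [MeasurableSpace X] (μ : Measure X) (m₁ m₂ : MeasurableSpace X) : Prop :=
  ∀ A : Set X, MeasurableSet[m₁] A → ∃ B : Set X, MeasurableSet[m₂] B ∧ μ (A ∆ B) = 0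

end Defs

section Defs2

variable {X : Type*}

/-- The σ-algebra `F^- = ⋁_{n ≥ 1} T^{-n} F`. -/
def pastAlg (T : X → X) (F : MeasurableSpace X) : MeasurableSpace X :=
  ⨆ n : ℕ, MeasurableSpace.comap (T^[n + 1]) F

/-- The σ-algebra `F^T = ⋁_{n ∈ ℤ} T^{-n} F`, where `S = T⁻¹`. -/
def hullAlg (T S : X → X) (F : MeasurableSpace X) : MeasurableSpace X :=
  ⨆ n : ℕ, MeasurableSpace.comap (T^[n]) F ⊔ MeasurableSpace.comap (S^[n]) F

/-- `P` is (the σ-algebra of) an *excellent* measurable partition for `(X, μ, T)` (here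
`S = T⁻¹`): it is generating (`σ(P^T) = 𝒜` mod `μ`) and it is generated by an increasing
sequence of finite measurable partitions `Pₙ ↑ P` with `H(Pₙ|Pₙ⁻) − H(Pₙ|P⁻) → 0`. -/
def IsExcellentPartition (P : MeasurableSpace X) [m0 : MeasurableSpace X] (μ : Measure X)
    (T S : X → X) : Prop :=
  P ≤ m0 ∧ SubModNull μ m0 (hullAlg T S P) ∧
  ∃ (m : ℕ → ℕ) (Q : ∀ n : ℕ, X → Fin (m n)),
    (∀ n, Measurable (Q n)) ∧
    Monotone (fun n => MeasurableSpace.comap (Q n) (⊤ : MeasurableSpace (Fin (m n)))) ∧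
    (⨆ n : ℕ, MeasurableSpace.comap (Q n) (⊤ : MeasurableSpace (Fin (m n)))) = P ∧
    Tendsto (fun n => condPartEntropy μ (partPast T (Q n)) (Q n) -
      condPartEntropy μ (pastAlg T P) (Q n)) atTop (𝓝 0)

end Defs2

section Comb

def shf (i : ℕ) (s : Set (ℕ × ℕ)) : Set (ℕ × ℕ) := (fun a => (a.1, a.2 + i)) '' s

def shfF (i : ℕ) (s : Finset (ℕ × ℕ)) : Finset (ℕ × ℕ) := s.image (fun a => (a.1, a.2 + i))

structure EntFn (h : Finset (ℕ × ℕ) → ℝ) : Prop where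
  empty : h ∅ = 0
  mono : ∀ s t, s ⊆ t → h s ≤ h t
  dim : ∀ r s t, s ⊆ t → h (r ∪ t) - h t ≤ h (r ∪ s) - h s
  shift : ∀ i s, h (shfF i s) = h s

noncomputable def cen (h : Finset (ℕ × ℕ) → ℝ) (r : Finset (ℕ × ℕ)) (S : Set (ℕ × ℕ)) : ℝ :=
  ⨅ s : {s : Finset (ℕ × ℕ) // (s : Set (ℕ × ℕ)) ⊆ S}, (h (r ∪ s.1) - h s.1)

variable {h : Finset (ℕ × ℕ) → ℝ}

lemma cen_bdd (E : EntFn h) (r : Finset (ℕ × ℕ)) (S : Set (ℕ × ℕ)) :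
    BddBelow (range fun s : {s : Finset (ℕ × ℕ) // (s : Set (ℕ × ℕ)) ⊆ S} =>
      (h (r ∪ s.1) - h s.1)) := by
  refine ⟨0, ?_⟩
  rintro _ ⟨s, rfl⟩
  have := E.mono s.1 (r ∪ s.1) Finset.subset_union_right
  simp only; linarith

lemma cen_le (E : EntFn h) (r : Finset (ℕ × ℕ)) (S : Set (ℕ × ℕ)) (s : Finset (ℕ × ℕ))
    (hs : (s : Set (ℕ × ℕ)) ⊆ S) : cen h r S ≤ h (r ∪ s) - h s :=
  ciInf_le (cen_bdd E r S) ⟨s, hs⟩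

lemma le_cen (r : Finset (ℕ × ℕ)) (S : Set (ℕ × ℕ)) (c : ℝ)
    (H : ∀ s : Finset (ℕ × ℕ), (s : Set (ℕ × ℕ)) ⊆ S → c ≤ h (r ∪ s) - h s) : c ≤ cen h r S := by
  have : Nonempty {s : Finset (ℕ × ℕ) // (s : Set (ℕ × ℕ)) ⊆ S} := ⟨⟨∅, by simp⟩⟩
  exact le_ciInf fun s => H s.1 s.2

lemma cen_lt (r : Finset (ℕ × ℕ)) (S : Set (ℕ × ℕ)) (c : ℝ) (hc : cen h r S < c) :
    ∃ s : Finset (ℕ × ℕ), (s : Set (ℕ × ℕ)) ⊆ S ∧ h (r ∪ s) - h s < c := by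
  by_contra! H
  exact absurd (le_cen r S c H) (not_le.2 hc)

lemma cen_anti (E : EntFn h) (r : Finset (ℕ × ℕ)) {S S' : Set (ℕ × ℕ)} (hS : S ⊆ S') :
    cen h r S' ≤ cen h r S :=
  le_cen _ _ _ fun s hs => cen_le E r S' s (hs.trans hS)

lemma cen_chain (E : EntFn h) (r r' : Finset (ℕ × ℕ)) (S : Set (ℕ × ℕ)) :
    cen h (r ∪ r') S = cen h r S + cen h r' (S ∪ r) := by
  apply le_antisymm
  · apply le_of_forall_pos_le_add
    intro ε hε
    obtain ⟨s1, h1, h1'⟩ := cen_lt (h := h) r S (cen h r S + ε / 2) (by linarith)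
    obtain ⟨s2, h2, h2'⟩ := cen_lt (h := h) r' (S ∪ r) (cen h r' (S ∪ r) + ε / 2) (by linarith)
    have a := cen_le E (r ∪ r') S (s1 ∪ (s2 \ r)) (by
      intro x hx
      simp only [Finset.coe_union, Finset.coe_sdiff, mem_union, Set.mem_sdiff, Finset.mem_coe] at hx
      rcases hx with hx | hx
      · exact h1 hx
      · rcases h2 hx.1 with h | h
        · exact h
        · exact absurd h hx.2)
    have b := E.dim r s1 (s1 ∪ (s2 \ r)) Finset.subset_union_left
    have c := E.dim r' s2 (r ∪ (s1 ∪ (s2 \ r))) (by intro x; simp; tauto)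
    have e : r ∪ r' ∪ (s1 ∪ s2 \ r) = r' ∪ (r ∪ (s1 ∪ s2 \ r)) := by ext x; simp; tauto
    rw [e] at a
    linarith
  · apply le_cen
    intro s hs
    have a := cen_le E r S s hs
    have b := cen_le E r' (S ∪ r) (r ∪ s) (by
      intro x; simp only [Finset.coe_union, mem_union]; rintro (h | h)
      · exact Or.inr h
      · exact Or.inl (hs h))
    have e : r ∪ r' ∪ s = r' ∪ (r ∪ s) := by ext x; simp; tauto
    rw [e]; linarith

lemma shf_coe (i : ℕ) (s : Finset (ℕ × ℕ)) : ((shfF i s : Finset (ℕ × ℕ)) : Set (ℕ × ℕ)) = shf i s := by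
  simp [shf, shfF]

lemma cen_shift (E : EntFn h) (i : ℕ) (r : Finset (ℕ × ℕ)) (S : Set (ℕ × ℕ)) :
    cen h (shfF i r) (shf i S) = cen h r S := by
  have un : ∀ s t, shfF i (s ∪ t) = shfF i s ∪ shfF i t := fun s t => by
    simp [shfF, Finset.image_union]
  apply le_antisymm
  · apply le_cen
    intro s hs
    have := cen_le E (shfF i r) (shf i S) (shfF i s) (by rw [shf_coe]; exact image_mono hs)
    rwa [← un, E.shift, E.shift] at this
  · apply le_cen
    intro s hs
    obtain ⟨t, ht, rfl⟩ : ∃ t : Finset (ℕ × ℕ), (t : Set (ℕ × ℕ)) ⊆ S ∧ shfF i t = s := by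
      obtain ⟨t, ht, e⟩ := Finset.subset_set_image_iff.1 hs
      exact ⟨t, ht, by simpa [shfF] using e⟩
    rw [← un, E.shift, E.shift]
    exact cen_le E r S t ht

/-- the block of shifts of `R` by `[0,m)` -/
def blk (R : Finset (ℕ × ℕ)) (m : ℕ) : Finset (ℕ × ℕ) := (Finset.range m).biUnion fun i => shfF i R

/-- all the shifts of `R` by `≥ m` -/
def tl (R : Finset (ℕ × ℕ)) (m : ℕ) : Set (ℕ × ℕ) := {a | ∃ b ∈ R, ∃ i, m ≤ i ∧ a = (b.1, b.2 + i)}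

def row (n k : ℕ) : Set (ℕ × ℕ) := {a | a.1 = n ∧ k ≤ a.2}

lemma mem_blk (R : Finset (ℕ × ℕ)) (m : ℕ) (a : ℕ × ℕ) :
    a ∈ blk R m ↔ ∃ b ∈ R, ∃ i, i < m ∧ a = (b.1, b.2 + i) := by
  simp only [blk, shfF, Finset.mem_biUnion, Finset.mem_range, Finset.mem_image]
  constructor
  · rintro ⟨i, hi, b, hb, rfl⟩; exact ⟨b, hb, i, hi, rfl⟩
  · rintro ⟨b, hb, i, hi, rfl⟩; exact ⟨i, hi, b, hb, rfl⟩

lemma blk_succ (R : Finset (ℕ × ℕ)) (m : ℕ) : blk R (m + 1) = R ∪ shfF 1 (blk R m) := by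
  ext a
  simp only [mem_blk, Finset.mem_union, shfF, Finset.mem_image]
  constructor
  · rintro ⟨b, hb, i, hi, rfl⟩
    rcases i with _ | i
    · left; simpa using hb
    · right; exact ⟨(b.1, b.2 + i), ⟨b, hb, i, by omega, rfl⟩, rfl⟩
  · rintro (h | ⟨_, ⟨b, hb, i, hi, rfl⟩, rfl⟩)
    · exact ⟨a, h, 0, by omega, rfl⟩
    · exact ⟨b, hb, i + 1, by omega, rfl⟩

lemma shf_tl (R : Finset (ℕ × ℕ)) (m : ℕ) : shf 1 (tl R m) = tl R (m + 1) := by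
  ext a
  simp only [shf, tl, mem_image, mem_ofPred_eq]
  constructor
  · rintro ⟨_, ⟨b, hb, i, hi, rfl⟩, rfl⟩
    exact ⟨b, hb, i + 1, by omega, rfl⟩
  · rintro ⟨b, hb, i, hi, rfl⟩
    obtain ⟨j, rfl⟩ : ∃ j, i = j + 1 := ⟨i - 1, by omega⟩
    exact ⟨_, ⟨b, hb, j, by omega, rfl⟩, rfl⟩

lemma shf_row (n m : ℕ) : shf 1 (row n m) = row n (m + 1) := by
  ext a
  simp only [shf, row, mem_image, mem_ofPred_eq]
  constructor
  · rintro ⟨b, ⟨rfl, h⟩, rfl⟩; simp; omega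
  · rintro ⟨rfl, h⟩
    exact ⟨(a.1, a.2 - 1), ⟨rfl, by simp; omega⟩, by ext <;> simp; omega⟩

lemma tl_blk (R : Finset (ℕ × ℕ)) (m : ℕ) :
    tl R (m + 1) ∪ (shfF 1 (blk R m) : Finset (ℕ × ℕ)) = tl R 1 := by
  ext a
  simp only [shf_coe, shf, tl, mem_union, mem_image, mem_ofPred_eq, Finset.mem_coe, mem_blk]
  constructor
  · rintro (⟨b, hb, i, hi, rfl⟩ | ⟨_, ⟨b, hb, i, hi, rfl⟩, rfl⟩)
    · exact ⟨b, hb, i, by omega, rfl⟩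
    · exact ⟨b, hb, i + 1, by omega, rfl⟩
  · rintro ⟨b, hb, i, hi, rfl⟩
    by_cases hh : m + 1 ≤ i
    · left; exact ⟨b, hb, i, by omega, rfl⟩
    · right
      obtain ⟨j, rfl⟩ : ∃ j, i = j + 1 := ⟨i - 1, by omega⟩
      exact ⟨_, ⟨b, hb, j, by omega, rfl⟩, rfl⟩

/-- chain rule on a block -/
lemma cen_blk (E : EntFn h) (R : Finset (ℕ × ℕ)) (n m : ℕ) :
    cen h (blk R m) (tl R m ∪ row n m) = ∑ k ∈ Finset.range m, cen h R (tl R 1 ∪ row n (k + 1)) := by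
  induction m with
  | zero =>
    simp only [Finset.range_zero, Finset.sum_empty]
    apply le_antisymm
    · have := cen_le E (blk R 0) (tl R 0 ∪ row n 0) ∅ (by simp)
      simpa [blk] using this
    · exact le_cen _ _ _ fun s hs => by simp [blk]
  | succ m ih =>
    have sh := cen_shift E 1 (blk R m) (tl R m ∪ row n m)
    have e : shf 1 (tl R m ∪ row n m) = tl R (m+1) ∪ row n (m+1) := by
      rw [← shf_tl, ← shf_row, shf, image_union]; rfl
    rw [e] at sh
    rw [Finset.sum_range_succ, ← ih, ← sh, blk_succ, Finset.union_comm, cen_chain E]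
    congr 2
    rw [← tl_blk R m]
    ext x; simp only [mem_union]; tauto

lemma cen_blk' (E : EntFn h) (R : Finset (ℕ × ℕ)) (m : ℕ) :
    cen h (blk R m) (tl R m) = m * cen h R (tl R 1) := by
  induction m with
  | zero =>
    simp only [Nat.cast_zero, zero_mul]
    apply le_antisymm
    · have := cen_le E (blk R 0) (tl R 0) ∅ (by simp)
      simpa [blk] using this
    · exact le_cen _ _ _ fun s hs => by simp [blk]
  | succ m ih =>
    have sh := cen_shift E 1 (blk R m) (tl R m)
    rw [shf_tl] at sh
    rw [blk_succ, Finset.union_comm, cen_chain E, sh, ih, tl_blk]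
    push_cast; ring

/-- upper bound on block entropies -/
lemma blk_upper (E : EntFn h) (R : Finset (ℕ × ℕ)) (ε : ℝ) (hε : 0 < ε) :
    ∃ K : ℝ, ∀ m : ℕ, h (blk R m) ≤ K + m * (cen h R (tl R 1) + ε) := by
  obtain ⟨s, hs, hs'⟩ := cen_lt (h := h) R (tl R 1) (cen h R (tl R 1) + ε) (by linarith)
  obtain ⟨m0, hm0⟩ : ∃ m0, ∀ m ≥ m0, s ⊆ shfF 1 (blk R m) := by
    refine ⟨s.sup Prod.snd, fun m hm a ha => ?_⟩
    obtain ⟨b, hb, i, hi, rfl⟩ := hs ha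
    have := Finset.le_sup (f := Prod.snd) ha
    simp only at this
    obtain ⟨j, rfl⟩ : ∃ j, i = j + 1 := ⟨i - 1, by omega⟩
    exact Finset.mem_image.2 ⟨(b.1, b.2 + j), (mem_blk _ _ _).2 ⟨b, hb, j, by omega, rfl⟩, rfl⟩
  have step : ∀ m ≥ m0, h (blk R (m + 1)) - h (blk R m) ≤ cen h R (tl R 1) + ε := by
    intro m hm
    have a := E.dim R s _ (hm0 m hm)
    rw [E.shift, ← blk_succ] at a
    linarith
  have mon : ∀ m, h (blk R m) ≤ h (blk R m0) ∨ m0 ≤ m := by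
    intro m
    by_cases hm : m0 ≤ m
    · exact Or.inr hm
    · left; apply E.mono; intro a; rw [mem_blk, mem_blk]
      rintro ⟨b, hb, i, hi, rfl⟩; exact ⟨b, hb, i, by omega, rfl⟩
  have nn : 0 ≤ cen h R (tl R 1) := le_cen _ _ _ fun s hs => by
    linarith [E.mono s (R ∪ s) Finset.subset_union_right]
  refine ⟨h (blk R m0), fun m => ?_⟩
  by_cases hm : m0 ≤ m
  · induction m, hm using Nat.le_induction with
    | base => have : 0 ≤ (m0 : ℝ) * (cen h R (tl R 1) + ε) := by positivity
              linarith
    | succ m hm ih => have := step m hm; push_cast; linarith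
  · have : 0 ≤ (m : ℝ) * (cen h R (tl R 1) + ε) := by positivity
    rcases mon m with h | h
    · linarith
    · exact absurd h hm

lemma key_step (E : EntFn h) (R : Finset (ℕ × ℕ)) (n : ℕ) (ε : ℝ) (hε : 0 < ε) :
    ∃ k, cen h R (tl R 1) - ε ≤ cen h R (tl R 1 ∪ row n (k + 1)) := by
  by_contra! H
  set c := cen h R (tl R 1) with hc
  set RS := R ∪ {(n, 0)} with hRS
  set d := cen h RS (tl RS 1) with hd
  obtain ⟨K, hK⟩ := blk_upper E RS (ε / 2) (by linarith)
  have main : ∀ m : ℕ, m * (d + ε) ≤ h (blk RS m) := by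
    intro m
    have e1 := cen_blk' E RS m
    have et : tl RS m = tl R m ∪ row n m := by
      ext a
      simp only [tl, row, hRS, mem_union, mem_ofPred_eq, Finset.mem_union, Finset.mem_singleton]
      constructor
      · rintro ⟨b, hb | rfl, i, hi, rfl⟩
        · left; exact ⟨b, hb, i, hi, rfl⟩
        · right; simpa using hi
      · rintro (⟨b, hb, i, hi, rfl⟩ | ⟨rfl, h⟩)
        · exact ⟨b, Or.inl hb, i, hi, rfl⟩
        · exact ⟨(a.1, 0), Or.inr rfl, a.2, h, by simp⟩
    have sub : blk R m ⊆ blk RS m := by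
      intro a; rw [mem_blk, mem_blk]
      rintro ⟨b, hb, i, hi, rfl⟩
      exact ⟨b, Finset.mem_union_left _ hb, i, hi, rfl⟩
    have eb : blk RS m = blk R m ∪ blk RS m := (Finset.union_eq_right.2 sub).symm
    rw [eb, cen_chain E, et, cen_blk E] at e1
    have a1 : ∑ k ∈ Finset.range m, cen h R (tl R 1 ∪ row n (k + 1)) ≤ m * (c - ε) := by
      have := Finset.sum_le_card_nsmul (Finset.range m) _ (c - ε) (fun k _ => (H k).le)
      simpa using this
    have a2 := cen_le E (blk RS m) (tl R m ∪ row n m ∪ blk R m) (blk R m) subset_union_right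
    rw [Finset.union_eq_left.2 sub] at a2
    have a3 := cen_le E (blk R m) (tl R m) ∅ (by simp)
    rw [cen_blk' E] at a3
    simp only [Finset.union_empty, E.empty, sub_zero] at a3
    linarith
  obtain ⟨m, hm⟩ := exists_nat_gt (K / (ε / 2))
  rw [div_lt_iff₀ (by linarith)] at hm
  have := main m; have := hK m
  linarith

lemma key_step' (E : EntFn h) (Q R : Finset (ℕ × ℕ)) (hQ : Q ⊆ R) (n : ℕ) (ε : ℝ) (hε : 0 < ε) :
    ∃ k, cen h Q (tl R 1) - ε ≤ cen h Q (tl (R ∪ {(n, k)}) 1) := by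
  obtain ⟨k, hk⟩ := key_step E R n ε hε
  refine ⟨k, ?_⟩
  have et : tl (R ∪ {(n, k)}) 1 = tl R 1 ∪ row n (k + 1) := by
    ext a
    simp only [tl, row, mem_union, mem_ofPred_eq, Finset.mem_union, Finset.mem_singleton]
    constructor
    · rintro ⟨b, hb | rfl, i, hi, rfl⟩
      · left; exact ⟨b, hb, i, hi, rfl⟩
      · right; simpa using hi
    · rintro (⟨b, hb, i, hi, rfl⟩ | ⟨rfl, h⟩)
      · exact ⟨b, Or.inl hb, i, hi, rfl⟩
      · exact ⟨(a.1, k), Or.inr rfl, a.2 - k, by omega, by ext <;> simp; omega⟩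
  rw [et]
  have e1 := cen_chain E Q R (tl R 1)
  have e2 := cen_chain E Q R (tl R 1 ∪ row n (k + 1))
  rw [Finset.union_eq_right.2 hQ] at e1 e2
  have := cen_anti E R (show tl R 1 ∪ (Q : Set (ℕ × ℕ)) ⊆ tl R 1 ∪ row n (k + 1) ∪ Q from
    fun x => by simp only [mem_union]; tauto)
  linarith

theorem comb_main (E : EntFn h) (Q : Finset (ℕ × ℕ)) (c : ℝ) (hc : 0 < c) (hQ : c ≤ cen h Q (tl Q 1)) :
    ∃ S : Set (ℕ × ℕ), (∀ n, ∃ k, ∀ j ≥ k, (n, j) ∈ S) ∧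
      ∀ s : Finset (ℕ × ℕ), (s : Set (ℕ × ℕ)) ⊆ S → c / 2 ≤ h (Q ∪ s) - h s := by
  have ex : ∀ (R : {R : Finset (ℕ × ℕ) // Q ⊆ R}) (n : ℕ), ∃ k,
      cen h Q (tl R.1 1) - c / 4 * (1 / 2) ^ n ≤ cen h Q (tl (R.1 ∪ {(n, k)}) 1) := fun R n =>
    key_step' E Q R.1 R.2 n _ (by positivity)
  choose k hk using ex
  let R : ℕ → {R : Finset (ℕ × ℕ) // Q ⊆ R} := fun n => Nat.rec ⟨Q, subset_rfl⟩
    (fun n R => ⟨R.1 ∪ {(n, k R n)}, R.2.trans Finset.subset_union_left⟩) n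
  have Rs : ∀ n, (R (n + 1)).1 = (R n).1 ∪ {(n, k (R n) n)} := fun n => rfl
  have low : ∀ n, c / 2 + c / 2 * (1 / 2) ^ n ≤ cen h Q (tl (R n).1 1) := by
    intro n
    induction n with
    | zero => have : (R 0).1 = Q := rfl
              rw [this]; simp; linarith
    | succ n ih => have := hk (R n) n
                   rw [← Rs] at this
                   rw [pow_succ]; linarith
  have Rm : Monotone fun n => (R n).1 := monotone_nat_of_le_succ fun n => by
    rw [Rs]; exact Finset.subset_union_left
  have tm : Monotone fun n => tl (R n).1 1 := fun a b hab x => by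
    rintro ⟨b, hb, r⟩; exact ⟨b, Rm hab hb, r⟩
  refine ⟨⋃ n, tl (R n).1 1, ?_, ?_⟩
  · intro n
    refine ⟨k (R n) n + 1, fun j hj => mem_iUnion.2 ⟨n + 1, (n, k (R n) n), ?_, j - k (R n) n, by omega, ?_⟩⟩
    · rw [Rs]; simp
    · ext <;> simp; omega
  · intro s hs
    obtain ⟨n, hn⟩ : ∃ n, (s : Set (ℕ × ℕ)) ⊆ tl (R n).1 1 := by
      exact (tm.directed_le).exists_mem_subset_of_finset_subset_biUnion hs
    have := cen_le E Q _ s hn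
    have := low n
    have : 0 ≤ c / 2 * (1 / 2) ^ n := by positivity
    linarith

end Comb

section Ent

lemma submod_real {α β γ : Type*} [Fintype α] [Fintype β] [Fintype γ] (p : α → β → γ → ℝ)
    (hp : ∀ a b c, 0 ≤ p a b c) :
    (∑ a, ∑ b, ∑ c, Real.negMulLog (p a b c)) + ∑ c, Real.negMulLog (∑ a, ∑ b, p a b c) ≤
    (∑ a, ∑ c, Real.negMulLog (∑ b, p a b c)) + ∑ b, ∑ c, Real.negMulLog (∑ a, p a b c) := by
  have key : ∀ c, (∑ a, ∑ b, Real.negMulLog (p a b c)) + Real.negMulLog (∑ a, ∑ b, p a b c) ≤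
      (∑ a, Real.negMulLog (∑ b, p a b c)) + ∑ b, Real.negMulLog (∑ a, p a b c) := by
    intro c
    set pc := ∑ a, ∑ b, p a b c with hpc
    set pa : α → ℝ := fun a => ∑ b, p a b c with hpa
    set pb : β → ℝ := fun b => ∑ a, p a b c with hpb
    have hpc0 : 0 ≤ pc := Finset.sum_nonneg fun a _ => Finset.sum_nonneg fun b _ => hp _ _ _
    have hpa0 : ∀ a, 0 ≤ pa a := fun a => Finset.sum_nonneg fun b _ => hp _ _ _
    have hpb0 : ∀ b, 0 ≤ pb b := fun b => Finset.sum_nonneg fun a _ => hp _ _ _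
    have e1 : Real.negMulLog pc = ∑ a, ∑ b, -(p a b c * Real.log pc) := by
      simp only [Real.negMulLog, Finset.sum_neg_distrib, ← Finset.sum_mul]
      rw [← hpc]; ring
    have e2 : ∀ a, Real.negMulLog (pa a) = ∑ b, -(p a b c * Real.log (pa a)) := by
      intro a
      simp only [Real.negMulLog, Finset.sum_neg_distrib, ← Finset.sum_mul]
      simp only [hpa]; ring
    have e3 : ∑ b, Real.negMulLog (pb b) = ∑ a, ∑ b, -(p a b c * Real.log (pb b)) := by
      rw [Finset.sum_comm]
      refine Finset.sum_congr rfl fun b _ => ?_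
      simp only [Real.negMulLog, Finset.sum_neg_distrib, ← Finset.sum_mul]
      simp only [hpb]; ring
    have e4 : ∑ a, ∑ b, (pa a * pb b / pc - p a b c) = 0 := by
      have : ∑ b, pb b = pc := by rw [hpc, Finset.sum_comm]
      simp only [Finset.sum_sub_distrib, ← Finset.sum_div, ← Finset.mul_sum, this,
        ← Finset.sum_mul]
      rw [← hpc]
      by_cases h0 : pc = 0
      · simp [h0]
      · field_simp; simp
    have pt : ∀ a b, Real.negMulLog (p a b c) + -(p a b c * Real.log pc) ≤
        -(p a b c * Real.log (pa a)) + -(p a b c * Real.log (pb b)) + (pa a * pb b / pc - p a b c) := by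
      intro a b
      rcases (hp a b c).eq_or_lt with h0 | h0
      · rw [← h0]; simp
        exact div_nonneg (mul_nonneg (hpa0 a) (hpb0 b)) hpc0
      · have la : p a b c ≤ pa a := Finset.single_le_sum (f := fun b => p a b c) (fun b _ => hp a b c) (Finset.mem_univ b)
        have lb : p a b c ≤ pb b := Finset.single_le_sum (f := fun a => p a b c) (fun a _ => hp a b c) (Finset.mem_univ a)
        have lc : pa a ≤ pc := Finset.single_le_sum (f := pa) (fun a _ => hpa0 a) (Finset.mem_univ a)
        have ha : 0 < pa a := by linarith
        have hb : 0 < pb b := by linarith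
        have hc : 0 < pc := by linarith
        have := Real.log_le_sub_one_of_pos (show 0 < pa a * pb b / (pc * p a b c) by positivity)
        rw [Real.log_div (by positivity) (by positivity), Real.log_mul ha.ne' hb.ne',
          Real.log_mul hc.ne' h0.ne'] at this
        have h2 := mul_le_mul_of_nonneg_left this h0.le
        have e : p a b c * (pa a * pb b / (pc * p a b c) - 1) = pa a * pb b / pc - p a b c := by
          field_simp
        rw [e] at h2
        simp only [Real.negMulLog]
        linarith
    have tot := Finset.sum_le_sum fun a (_ : a ∈ Finset.univ) =>
      Finset.sum_le_sum fun b (_ : b ∈ Finset.univ) => pt a b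
    simp only [Finset.sum_add_distrib] at tot
    rw [e4, ← e1, ← e3] at tot
    simp only [← e2] at tot
    linarith
  have := Finset.sum_le_sum fun c (_ : c ∈ Finset.univ) => key c
  simp only [Finset.sum_add_distrib] at this
  have r1 : ∑ a, ∑ b, ∑ c, Real.negMulLog (p a b c) = ∑ c, ∑ a, ∑ b, Real.negMulLog (p a b c) := by
    rw [Finset.sum_comm' (t' := Finset.univ) (s' := fun _ => Finset.univ) (by simp)]
    simp_rw [Finset.sum_comm (s := (Finset.univ : Finset α)) (t := (Finset.univ : Finset γ))]
    rw [Finset.sum_comm]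
    refine Finset.sum_congr rfl fun c _ => Finset.sum_comm
  rw [r1, Finset.sum_comm (s := (Finset.univ : Finset α)) (t := (Finset.univ : Finset γ)),
    Finset.sum_comm (s := (Finset.univ : Finset β)) (t := (Finset.univ : Finset γ))]
  exact this

variable {X : Type*} [MeasurableSpace X] (μ : Measure X) [IsProbabilityMeasure μ]

/-- all fibres measurable -/
def FM {ι : Type*} (f : X → ι) : Prop := ∀ i, MeasurableSet (f ⁻¹' {i})

lemma ent_congr {ι κ : Type*} [Fintype ι] [Fintype κ] (f : X → ι) (g : X → κ)
    (hfg : ∀ x y, f x = f y ↔ g x = g y) : partEntropy μ f = partEntropy μ g := by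
  have ne : ∀ {ι : Type _} (f : X → ι) (i : ι), Real.negMulLog (μ (f ⁻¹' {i})).toReal ≠ 0 → ∃ x, f x = i := by
    intro ι f i hi
    by_contra! H
    apply hi
    have : f ⁻¹' {i} = ∅ := by ext x; simpa using H x
    simp [this]
  have ne' : ∀ {ι : Type _} (f : X → ι) (i : ι), Real.negMulLog (μ (f ⁻¹' {i})).toReal ≠ 0 → ∃ x, f x = i := by
    intro ι f i hi
    by_contra! H
    apply hi
    have : f ⁻¹' {i} = ∅ := by ext x; simpa using H x
    simp [this]
  have fib : ∀ x, f ⁻¹' {f x} = g ⁻¹' {g x} := fun x => by ext y; simpa using hfg y x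
  unfold partEntropy
  refine Finset.sum_bij_ne_zero (fun i _ hi => g (ne f i hi).choose) (by simp) ?_ ?_ ?_
  · intro i _ hi j _ hj h
    have := (hfg _ _).2 h
    rwa [(ne f i hi).choose_spec, (ne f j hj).choose_spec] at this
  · intro k _ hk
    obtain ⟨x, rfl⟩ := ne' g k hk
    refine ⟨f x, Finset.mem_univ _, by rwa [fib], ?_⟩
    rw [← hfg]
    exact (ne f (f x) (by rwa [fib])).choose_spec
  · intro i _ hi
    have := (ne f i hi).choose_spec
    rw [← fib, this]

lemma marg {ι κ : Type*} [Fintype κ] (f : X → ι) (g : X → κ) (hf : FM f) (hg : FM g) (i : ι) :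
    (μ (f ⁻¹' {i})).toReal = ∑ k, (μ ((fun x => (f x, g x)) ⁻¹' {(i, k)})).toReal := by
  have : f ⁻¹' {i} = ⋃ k, (fun x => (f x, g x)) ⁻¹' {(i, k)} := by ext x; simp
  rw [this, measure_iUnion, tsum_fintype, ENNReal.toReal_sum (fun _ _ => measure_ne_top _ _)]
  · intro a b hab
    rw [Function.onFun, Set.disjoint_left]
    intro x hx hy
    simp at hx hy
    exact hab (hx.2 ▸ hy.2)
  · intro k
    have : (fun x => (f x, g x)) ⁻¹' {(i, k)} = f ⁻¹' {i} ∩ g ⁻¹' {k} := by ext x; simp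
    rw [this]; exact (hf i).inter (hg k)

lemma FM.pair {ι κ : Type*} {f : X → ι} {g : X → κ} (hf : FM f) (hg : FM g) : FM (fun x => (f x, g x)) := by
  rintro ⟨i, k⟩
  have : (fun x => (f x, g x)) ⁻¹' {(i, k)} = f ⁻¹' {i} ∩ g ⁻¹' {k} := by ext x; simp
  rw [this]; exact (hf i).inter (hg k)

lemma ent_submod {α β γ : Type*} [Fintype α] [Fintype β] [Fintype γ] (f : X → α) (g : X → β) (k : X → γ)
    (hf : FM f) (hg : FM g) (hk : FM k) :
    partEntropy μ (fun x => (f x, g x, k x)) + partEntropy μ k ≤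
      partEntropy μ (fun x => (f x, k x)) + partEntropy μ (fun x => (g x, k x)) := by
  have := submod_real (fun a b c => (μ ((fun x => (f x, g x, k x)) ⁻¹' {(a, b, c)})).toReal)
    (fun _ _ _ => ENNReal.toReal_nonneg)
  have e2 : ∀ a c, (μ ((fun x => (f x, k x)) ⁻¹' {(a, c)})).toReal = ∑ b, (μ ((fun x => (f x, g x, k x)) ⁻¹' {(a, b, c)})).toReal := by
    intro a c
    rw [marg μ _ g (hf.pair hk) hg]
    refine Finset.sum_congr rfl fun b _ => ?_
    congr 2; ext x; simp; tauto
  have e3 : ∀ b c, (μ ((fun x => (g x, k x)) ⁻¹' {(b, c)})).toReal = ∑ a, (μ ((fun x => (f x, g x, k x)) ⁻¹' {(a, b, c)})).toReal := by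
    intro b c
    rw [marg μ _ f (hg.pair hk) hf]
    refine Finset.sum_congr rfl fun a _ => ?_
    congr 2; ext x; simp; tauto
  have e1 : ∀ c, (μ (k ⁻¹' {c})).toReal = ∑ a, ∑ b, (μ ((fun x => (f x, g x, k x)) ⁻¹' {(a, b, c)})).toReal := by
    intro c
    rw [marg μ _ f hk hf]
    refine Finset.sum_congr rfl fun a _ => ?_
    rw [← e2]
    congr 2; ext x; simp; tauto
  simp only [← e1] at this
  simp only [← e2, ← e3] at this
  simpa [partEntropy, Fintype.sum_prod_type] using this

lemma ent_mono {ι κ : Type*} [Fintype ι] [Fintype κ] (f : X → ι) (g : X → κ) (hf : FM f) (hg : FM g) :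
    partEntropy μ f ≤ partEntropy μ (fun x => (f x, g x)) := by
  unfold partEntropy
  rw [Fintype.sum_prod_type]
  refine Finset.sum_le_sum fun i _ => ?_
  rw [marg μ f g hf hg i]
  set q : κ → ℝ := fun k => (μ ((fun x => (f x, g x)) ⁻¹' {(i, k)})).toReal
  have hq : ∀ k, 0 ≤ q k := fun k => ENNReal.toReal_nonneg
  change Real.negMulLog (∑ k, q k) ≤ ∑ k, Real.negMulLog (q k)
  have : Real.negMulLog (∑ k, q k) = ∑ k, -(q k * Real.log (∑ k, q k)) := by
    simp only [Real.negMulLog, Finset.sum_neg_distrib, ← Finset.sum_mul]; ring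
  rw [this]
  refine Finset.sum_le_sum fun k _ => ?_
  rw [Real.negMulLog, neg_mul, neg_le_neg_iff]
  rcases (hq k).eq_or_lt with h | h
  · simp [← h]
  · exact mul_le_mul_of_nonneg_left (Real.log_le_log h
      (Finset.single_le_sum (fun k _ => hq k) (Finset.mem_univ k))) (hq k)

lemma ent_const {ι : Type*} [Fintype ι] [Unique ι] (f : X → ι) : partEntropy μ f = 0 := by
  have : f ⁻¹' {default} = univ := by ext x; simp [eq_iff_true_of_subsingleton]
  simp [partEntropy, this]

/-- Jensen: conditioning on a finer σ-algebra. -/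
lemma cond_le {X : Type*} {ι κ : Type*} [Fintype ι] [Fintype κ] (F : MeasurableSpace X) [m0 : MeasurableSpace X]
    (μ : Measure X) [IsProbabilityMeasure μ] (hF : F ≤ m0)
    (f : X → ι) (k : X → κ) (hf : FM f) (hk : ∀ i, MeasurableSet[F] (k ⁻¹' {i})) :
    condPartEntropy μ F f ≤ partEntropy μ (fun x => (f x, k x)) - partEntropy μ k := by
  have hk' : FM k := fun i => hF _ (hk i)
  set m : ι → κ → ℝ := fun i c => (μ ((fun x => (f x, k x)) ⁻¹' {(i, c)})).toReal with hm
  set n : κ → ℝ := fun c => (μ (k ⁻¹' {c})).toReal with hn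
  have hmn : ∀ c, n c = ∑ i, m i c := by
    intro c
    simp only [hn, hm]
    rw [marg μ k f hk' hf]
    refine Finset.sum_congr rfl fun i _ => ?_
    congr 2; ext x; simp; tauto
  have facts : ∀ i, 0 ≤ᵐ[μ] μ[(f ⁻¹' {i}).indicator (fun _ => (1 : ℝ)) | F] ∧
      Integrable (Real.negMulLog ∘ μ[(f ⁻¹' {i}).indicator (fun _ => (1 : ℝ)) | F]) μ := by
    intro i
    set g := μ[(f ⁻¹' {i}).indicator (fun _ => (1 : ℝ)) | F] with hg
    have hint : Integrable ((f ⁻¹' {i}).indicator (fun _ => (1 : ℝ))) μ :=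
      (integrable_const _).indicator (hf i)
    have g0 : 0 ≤ᵐ[μ] g := condExp_nonneg (ae_of_all _ fun x => indicator_nonneg (by simp) x)
    have g1 : g ≤ᵐ[μ] fun _ => (1 : ℝ) := by
      have := condExp_mono (m := F) hint (integrable_const (1 : ℝ))
        (ae_of_all μ fun x => indicator_le_self' (by simp) x)
      rwa [condExp_const hF] at this
    have gi : Integrable g μ := integrable_condExp
    have ngi : Integrable (Real.negMulLog ∘ g) μ := by
      refine Integrable.of_bound (C := 1) (Real.continuous_negMulLog.comp_aestronglyMeasurable gi.1) ?_
      filter_upwards [g0, g1] with x h0 h1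
      have a := Real.negMulLog_nonneg h0 h1
      have b := Real.negMulLog_le_one_sub_self h0
      simp only [Function.comp, Real.norm_eq_abs, abs_of_nonneg a]
      simp at h0; linarith
    exact ⟨g0, ngi⟩
  have cell : ∀ i c, ∫ x in k ⁻¹' {c}, Real.negMulLog ((μ[(f ⁻¹' {i}).indicator (fun _ => (1 : ℝ)) | F]) x) ∂μ
      ≤ Real.negMulLog (m i c) + m i c * Real.log (n c) := by
    intro i c
    obtain ⟨g0, ngi⟩ := facts i
    set g := μ[(f ⁻¹' {i}).indicator (fun _ => (1 : ℝ)) | F] with hg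
    have hint : Integrable ((f ⁻¹' {i}).indicator (fun _ => (1 : ℝ))) μ :=
      (integrable_const _).indicator (hf i)
    have gi : Integrable g μ := integrable_condExp
    have ig : ∫ x in k ⁻¹' {c}, g x ∂μ = m i c := by
      rw [hg, setIntegral_condExp hF hint (hk c), integral_indicator (hf i),
        Measure.restrict_restrict (hf i)]
      simp [hm, Measure.real]
      congr 2; ext x; simp
    by_cases h0 : μ (k ⁻¹' {c}) = 0
    · have : m i c = 0 := by
        simp only [hm]
        rw [measure_mono_null (t := k ⁻¹' {c}) (by intro x; simp) h0]; simp
      rw [this, Measure.restrict_eq_zero.2 h0]; simp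
    · have J := Real.concaveOn_negMulLog.le_map_set_average Real.continuous_negMulLog.continuousOn
        isClosed_Ici h0 (measure_ne_top _ _) (ae_restrict_of_ae (g0.mono fun x hx => hx))
        gi.integrableOn ngi.integrableOn
      rw [setAverage_eq, setAverage_eq, ig] at J
      have np : 0 < n c := ENNReal.toReal_pos h0 (measure_ne_top _ _)
      have er : μ.real (k ⁻¹' {c}) = n c := rfl
      rw [er, smul_eq_mul, smul_eq_mul, inv_mul_le_iff₀ np] at J
      refine J.trans (le_of_eq ?_)
      rw [Real.negMulLog_mul]
      simp only [Real.negMulLog, Real.log_inv]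
      field_simp
      ring
  have split : ∀ i, ∫ x, Real.negMulLog ((μ[(f ⁻¹' {i}).indicator (fun _ => (1 : ℝ)) | F]) x) ∂μ
      ≤ ∑ c, (Real.negMulLog (m i c) + m i c * Real.log (n c)) := by
    intro i
    refine le_trans (le_of_eq ?_) (Finset.sum_le_sum fun c _ => cell i c)
    have hu : (⋃ c, k ⁻¹' {c}) = univ := by ext x; simp
    have ii := integral_iUnion_fintype (μ := μ) hk' (fun a b hab => by
      rw [Function.onFun, Set.disjoint_left]
      intro x hx hy
      simp at hx hy
      exact hab (hx ▸ hy)) (fun c => (facts i).2.integrableOn)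
    rw [hu, setIntegral_univ] at ii
    exact ii
  have := Finset.sum_le_sum fun i (_ : i ∈ Finset.univ) => split i
  refine this.trans (le_of_eq ?_)
  rw [Finset.sum_comm]
  simp only [partEntropy, Fintype.sum_prod_type]
  rw [Finset.sum_comm (s := (Finset.univ : Finset ι)), ← Finset.sum_sub_distrib]
  refine Finset.sum_congr rfl fun c _ => ?_
  rw [Finset.sum_add_distrib, ← Finset.sum_mul, ← hmn]
  simp only [Real.negMulLog, hm, hn]; ring

end Ent

section Final

variable {X : Type*}

noncomputable def code (U : ℕ → Set X) (T : X → X) (s : Finset (ℕ × ℕ)) (x : X) : s → Bool :=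
  fun a => decide (T^[a.1.2] x ∈ U a.1.1)

lemma code_eq (U : ℕ → Set X) (T : X → X) (s : Finset (ℕ × ℕ)) (x y : X) :
    code U T s x = code U T s y ↔ ∀ a ∈ s, (T^[a.2] x ∈ U a.1 ↔ T^[a.2] y ∈ U a.1) := by
  simp [code, funext_iff]

lemma code_union (U : ℕ → Set X) (T : X → X) (s t : Finset (ℕ × ℕ)) (x y : X) :
    code U T (s ∪ t) x = code U T (s ∪ t) y ↔
      code U T s x = code U T s y ∧ code U T t x = code U T t y := by
  simp only [code_eq, Finset.mem_union]
  exact ⟨fun H => ⟨fun a ha => H a (Or.inl ha), fun a ha => H a (Or.inr ha)⟩,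
    fun H a ha => ha.elim (H.1 a) (H.2 a)⟩

lemma code_mono (U : ℕ → Set X) (T : X → X) {s t : Finset (ℕ × ℕ)} (hst : s ⊆ t) (x y : X)
    (h : code U T t x = code U T t y) : code U T s x = code U T s y := by
  rw [code_eq] at h ⊢
  exact fun a ha => h a (hst ha)

lemma code_fib (U : ℕ → Set X) (T : X → X) (m : MeasurableSpace X) (s : Finset (ℕ × ℕ))
    (hU : ∀ a ∈ s, MeasurableSet[m] (T^[a.2] ⁻¹' (U a.1))) (i : s → Bool) :
    MeasurableSet[m] (code U T s ⁻¹' {i}) := by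
  have : code U T s ⁻¹' {i} = ⋂ a : s, {x | decide (x ∈ T^[a.1.2] ⁻¹' (U a.1.1)) = i a} := by
    ext x; simp [code, funext_iff]
  rw [this]
  refine MeasurableSet.iInter fun a => ?_
  cases i a
  · have e : {x | decide (x ∈ T^[a.1.2] ⁻¹' (U a.1.1)) = false} = (T^[a.1.2] ⁻¹' (U a.1.1))ᶜ := by
      ext x; simp only [Set.mem_ofPred_eq, decide_eq_false_iff_not, Set.mem_compl_iff]
    rw [e]; exact (hU a.1 a.2).compl
  · have e : {x | decide (x ∈ T^[a.1.2] ⁻¹' (U a.1.1)) = true} = T^[a.1.2] ⁻¹' (U a.1.1) := by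
      ext x; simp only [Set.mem_ofPred_eq, decide_eq_true_eq]
    rw [e]; exact hU a.1 a.2

lemma entFn_code [MeasurableSpace X] (μ : Measure X) [IsProbabilityMeasure μ] (T : X → X)
    (hT : MeasurePreserving T μ μ) (U : ℕ → Set X) (hU : ∀ n, MeasurableSet (U n)) :
    EntFn (fun s => partEntropy μ (code U T s)) := by
  have fm : ∀ s, FM (code U T s) := fun s i => code_fib U T _ s
    (fun a _ => (hT.iterate a.2).measurable (hU _)) i
  refine ⟨?_, ?_, ?_, ?_⟩
  · exact ent_const μ _
  · intro s t hst
    refine (ent_mono μ _ (code U T t) (fm s) (fm t)).trans (le_of_eq (ent_congr μ _ _ ?_))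
    intro x y
    simp only [Prod.mk.injEq]
    exact ⟨fun h => h.2, fun h => ⟨code_mono U T hst x y h, h⟩⟩
  · intro r s t hst
    have := ent_submod μ (code U T r) (code U T t) (code U T s) (fm _) (fm _) (fm _)
    have e1 : partEntropy μ (fun x => (code U T r x, code U T t x, code U T s x)) =
        partEntropy μ (code U T (r ∪ t)) := ent_congr μ _ _ fun x y => by
      rw [code_union]; simp only [Prod.mk.injEq]
      have := code_mono U T hst x y; tauto
    have e2 : partEntropy μ (fun x => (code U T r x, code U T s x)) =
        partEntropy μ (code U T (r ∪ s)) := ent_congr μ _ _ fun x y => by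
      rw [code_union]; simp only [Prod.mk.injEq]
    have e3 : partEntropy μ (fun x => (code U T t x, code U T s x)) =
        partEntropy μ (code U T t) := ent_congr μ _ _ fun x y => by
      simp only [Prod.mk.injEq]
      have := code_mono U T hst x y; tauto
    rw [e1, e2, e3] at this
    linarith
  · intro i s
    have e : partEntropy μ (code U T (shfF i s)) = partEntropy μ (fun x => code U T s (T^[i] x)) :=
      ent_congr μ _ _ fun x y => by
        rw [code_eq, code_eq]
        simp only [shfF, Finset.forall_mem_image, Function.iterate_add_apply]
    rw [e]
    unfold partEntropy
    refine Finset.sum_congr rfl fun c _ => ?_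
    have := (hT.iterate i).measure_preimage (fm s c).nullMeasurableSet
    rw [← this]; rfl

/-- entropy of the symmetric difference bounds the conditional entropy -/
lemma ent_symmDiff_le [MeasurableSpace X] (μ : Measure X) [IsProbabilityMeasure μ] {κ : Type*} [Fintype κ]
    (A B : Set X) (hA : MeasurableSet A) (hB : MeasurableSet B) (k : X → κ) (hk : FM k)
    (hBk : ∀ x y, k x = k y → (x ∈ B ↔ y ∈ B)) :
    partEntropy μ (fun x => (decide (x ∈ A), k x)) - partEntropy μ k ≤
      Real.negMulLog (μ.real (B ∆ A)) + Real.negMulLog (1 - μ.real (B ∆ A)) := by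
  have hD : MeasurableSet (B ∆ A) := hB.symmDiff hA
  have p1 : (fun x => decide (x ∈ B ∆ A)) ⁻¹' {true} = B ∆ A := by ext x; simp
  have p2 : (fun x => decide (x ∈ B ∆ A)) ⁻¹' {false} = (B ∆ A)ᶜ := by
    ext x
    simp only [mem_preimage, mem_singleton_iff, decide_eq_false_iff_not, Set.mem_compl_iff]
  have fD : FM (fun x => decide (x ∈ B ∆ A)) := by
    intro i; cases i
    · rw [p2]; exact hD.compl
    · rw [p1]; exact hD
  have hu : FM (fun _ : X => ()) := fun i => by simp
  have s := ent_submod μ (fun x => decide (x ∈ B ∆ A)) k (fun _ => ()) fD hk hu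
  have e0 : partEntropy μ (fun _ : X => ()) = 0 := ent_const μ _
  have e1 : partEntropy μ (fun x => (decide (x ∈ B ∆ A), k x, ())) =
      partEntropy μ (fun x => (decide (x ∈ A), k x)) := ent_congr μ _ _ fun x y => by
    have := hBk x y
    simp only [Prod.mk.injEq, decide_eq_decide, Set.mem_symmDiff]; tauto
  have e2 : partEntropy μ (fun x => (decide (x ∈ B ∆ A), ())) =
      partEntropy μ (fun x => decide (x ∈ B ∆ A)) := ent_congr μ _ _ fun x y => by simp
  have e3 : partEntropy μ (fun x => (k x, ())) = partEntropy μ k := ent_congr μ _ _ fun x y => by simp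
  have e4 : partEntropy μ (fun x => decide (x ∈ B ∆ A)) =
      Real.negMulLog (μ.real (B ∆ A)) + Real.negMulLog (1 - μ.real (B ∆ A)) := by
    unfold partEntropy
    rw [Fintype.sum_bool, p1, p2, ← probReal_compl_eq_one_sub hD]; rfl
  rw [e0, e1, e2, e3, e4] at s
  linarith

/-- A set which is a union of atoms is approximated by finitely many coordinates. -/
lemma approx_code [m0 : MeasurableSpace X] [StandardBorelSpace X] (μ : Measure X) [IsProbabilityMeasure μ]
    (T : X → X) (hT : Measurable T) (U : ℕ → Set X) (hU : ∀ n, MeasurableSet (U n))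
    (S : Set (ℕ × ℕ)) (A : Set X) (hA : MeasurableSet A)
    (sat : ∀ x ∈ A, ∀ y ∈ Aᶜ, ∃ a ∈ S, ¬ (T^[a.2] x ∈ U a.1 ↔ T^[a.2] y ∈ U a.1))
    (ε : ℝ≥0∞) (hε : 0 < ε) :
    ∃ (s : Finset (ℕ × ℕ)) (B : Set X), (s : Set (ℕ × ℕ)) ⊆ S ∧ MeasurableSet B ∧
      (∀ x y, code U T s x = code U T s y → (x ∈ B ↔ y ∈ B)) ∧ μ (B ∆ A) < ε := by
  let F : X → (S → Bool) := fun x a => decide (T^[a.1.2] x ∈ U a.1.1)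
  have hF : Measurable F := by
    refine measurable_pi_lambda _ fun a => ?_
    exact measurable_to_bool (by
      have : (fun x => F x a) ⁻¹' {true} = T^[a.1.2] ⁻¹' (U a.1.1) := by ext x; simp [F]
      rw [this]
      exact (hT.iterate _) (hU _))
  have sep : MeasurablySeparable (F '' A) (F '' Aᶜ) := by
    refine AnalyticSet.measurablySeparable (hA.analyticSet_image hF) (hA.compl.analyticSet_image hF) ?_
    rw [Set.disjoint_left]
    rintro _ ⟨x, hx, rfl⟩ ⟨y, hy, hxy⟩
    obtain ⟨a, ha, hn⟩ := sat x hx y hy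
    apply hn
    have := congrFun hxy ⟨a, ha⟩
    simp only [F, decide_eq_decide] at this
    exact this.symm
  obtain ⟨C, hC1, hC2, hCm⟩ := sep
  have hAC : A = F ⁻¹' C := by
    ext x
    constructor
    · intro hx; exact hC1 ⟨x, hx, rfl⟩
    · intro hx; by_contra hn
      exact Set.disjoint_left.1 hC2 ⟨x, hn, rfl⟩ hx
  have : IsProbabilityMeasure (μ.map F) := Measure.isProbabilityMeasure_map hF.aemeasurable
  have alg : IsSetRing (measurableCylinders (fun _ : S => Bool)) :=
    { empty_mem := empty_mem_measurableCylinders _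
      union_mem := fun _ _ => union_mem_measurableCylinders
      sdiff_mem := fun _ _ => sdiff_mem_measurableCylinders }
  obtain ⟨t, ht, htC⟩ := exists_measure_symmDiff_lt_of_generateFrom_isSetRing (μ := μ.map F) alg
    ⟨{univ}, by simp, singleton_subset_iff.2 (univ_mem_measurableCylinders _), by simp⟩
    generateFrom_measurableCylinders.symm hCm hε
  have htm := MeasurableSet.of_mem_measurableCylinders ht
  obtain ⟨I, V, hV, rfl⟩ := (mem_measurableCylinders _).1 ht
  refine ⟨I.image Subtype.val, F ⁻¹' (cylinder I V), ?_, hF htm, ?_, ?_⟩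
  · intro a ha
    simp only [Finset.coe_image, mem_image] at ha
    obtain ⟨b, _, rfl⟩ := ha
    exact b.2
  · intro x y hxy
    rw [code_eq] at hxy
    simp only [mem_preimage, mem_cylinder]
    have : I.restrict (F x) = I.restrict (F y) := by
      ext a
      simp only [Finset.restrict, F]
      rw [decide_eq_decide.2 (hxy a.1.1 (Finset.mem_image_of_mem _ a.2))]
    rw [this]
  · rw [Measure.map_apply hF (htm.symmDiff hCm)] at htC
    rw [hAC]
    exact htC

/-- Points with eventually equal itineraries through a basis are asymptotic. -/
lemma asym_of_basis [MetricSpace X] [CompactSpace X] (T : X → X) (U : ℕ → Set X)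
    (hU : TopologicalSpace.IsTopologicalBasis (range U)) (x y : X)
    (H : ∀ n, ∃ k, ∀ j ≥ k, (T^[j] x ∈ U n ↔ T^[j] y ∈ U n)) : IsAsymptoticPair T x y := by
  rw [IsAsymptoticPair, Metric.tendsto_atTop]
  intro ε hε
  have : ∀ z : X, ∃ n, z ∈ U n ∧ U n ⊆ Metric.ball z (ε / 2) := by
    intro z
    obtain ⟨_, ⟨n, rfl⟩, h1, h2⟩ := hU.exists_subset_of_mem_open
      (Metric.mem_ball_self (x := z) (half_pos hε)) Metric.isOpen_ball
    exact ⟨n, h1, h2⟩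
  choose n hn1 hn2 using this
  obtain ⟨t, ht⟩ := isCompact_univ.elim_finite_subcover (fun z => U (n z))
    (fun z => hU.isOpen ⟨_, rfl⟩) (fun z _ => mem_iUnion.2 ⟨z, hn1 z⟩)
  choose k hk using H
  refine ⟨t.sup fun z => k (n z), fun j hj => ?_⟩
  obtain ⟨z, hz, hxz⟩ : ∃ z ∈ t, T^[j] x ∈ U (n z) := by simpa using ht (mem_univ (T^[j] x))
  have hyz := (hk (n z) j ((Finset.le_sup (f := fun z => k (n z)) hz).trans hj)).1 hxz
  have a := hn2 z hxz
  have b := hn2 z hyz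
  rw [Metric.mem_ball] at a b
  rw [Real.dist_0_eq_abs, abs_of_nonneg dist_nonneg]
  have := dist_triangle_right (T^[j] x) (T^[j] y) z
  linarith

end Final

/-- If `Q = (A, Aᶜ)` is a two-set Borel partition with `h_μ(Q,T) > 0`
for a `T`-ergodic measure `μ`, then there is an asymptotic pair `(x₁, x₂)` with
`x₁ ∈ A` and `x₂ ∈ Aᶜ`. -/
theorem partition_positive_entropy_separates_asymptotic_pair
    {X : Type*} [MetricSpace X] [CompactSpace X] [m0 : MeasurableSpace X] [BorelSpace X]
    (T : X ≃ₜ X) (μ : Measure X) [IsProbabilityMeasure μ] (herg : Ergodic (⇑T) μ)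
    (A : Set X) (hA : MeasurableSet A)
    (hpos : 0 < partKS μ (⇑T) (fun z => if z ∈ A then (0 : Fin 2) else 1)) :
    ∃ x₁ ∈ A, ∃ x₂ ∈ Aᶜ, IsAsymptoticPair (⇑T) x₁ x₂ := by
  by_contra! hcon
  obtain ⟨V, hVb⟩ : ∃ V : ℕ → Set X, TopologicalSpace.IsTopologicalBasis (range V) := by
    have hb := TopologicalSpace.isBasis_countableBasis X
    have hc := TopologicalSpace.countable_countableBasis X
    have : (TopologicalSpace.countableBasis X).Nonempty := by
      have : Nonempty X := nonempty_of_isProbabilityMeasure μ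
      obtain ⟨x⟩ := this
      obtain ⟨v, hv, _⟩ := hb.exists_subset_of_mem_open (mem_univ x) isOpen_univ
      exact ⟨v, hv⟩
    obtain ⟨V, hV⟩ := hc.exists_eq_range this
    exact ⟨V, hV ▸ hb⟩
  let U : ℕ → Set X := fun n => Nat.casesOn n A V
  have U0 : U 0 = A := rfl
  have hU : ∀ n, MeasurableSet (U n) := by
    intro n
    cases n with
    | zero => exact hA
    | succ n => exact (hVb.isOpen ⟨n, rfl⟩).measurableSet
  have hTp := herg.toMeasurePreserving
  have E := entFn_code μ T hTp U hU
  have fm : ∀ s, FM (code U T s) := fun s i => code_fib U T _ s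
    (fun a _ => (hTp.iterate a.2).measurable (hU _)) i
  set c := partKS μ (⇑T) (fun z => if z ∈ A then (0 : Fin 2) else 1) with hc
  have hF : partPast (⇑T) (fun z => if z ∈ A then (0 : Fin 2) else 1) ≤ m0 := by
    refine iSup_le fun n => ?_
    rw [← measurable_iff_comap_le]
    exact (Measurable.ite (show MeasurableSet {z | z ∈ A} from hA) measurable_const measurable_const).comp (hTp.iterate (n + 1)).measurable
  have low : c ≤ cen (fun s => partEntropy μ (code U T s)) {(0, 0)} (tl {(0, 0)} 1) := by
    refine le_cen _ _ _ fun s hs => ?_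
    have := cond_le (partPast (⇑T) (fun z => if z ∈ A then (0 : Fin 2) else 1)) μ hF
      (fun z => if z ∈ A then (0 : Fin 2) else 1) (code U T s)
      (fun i => (Measurable.ite (show MeasurableSet {z | z ∈ A} from hA) measurable_const measurable_const) (measurableSet_singleton i))
      (fun i => code_fib U T _ s (fun a ha => by
        obtain ⟨b, hb, j, hj, rfl⟩ := hs ha
        rw [Finset.mem_singleton] at hb
        subst hb
        obtain ⟨j, rfl⟩ : ∃ i, j = i + 1 := ⟨j - 1, by omega⟩
        refine (le_iSup (fun n : ℕ => MeasurableSpace.comap (fun x =>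
          (fun z => if z ∈ A then (0 : Fin 2) else 1) ((⇑T)^[n + 1] x)) ⊤) j) _ ?_
        refine ⟨{0}, trivial, ?_⟩
        ext x
        by_cases hx : (⇑T)^[j + 1] x ∈ A
        · simp [U0, -Function.iterate_succ, hx]
        · simp [U0, -Function.iterate_succ, hx]) i)
    refine this.trans (le_of_eq ?_)
    congr 1
    refine ent_congr μ _ _ fun x y => ?_
    rw [code_union, Prod.mk.injEq]
    refine and_congr ?_ Iff.rfl
    rw [code_eq]
    simp only [Finset.mem_singleton, forall_eq, U0, Function.iterate_zero, id]
    by_cases hx : x ∈ A <;> by_cases hy : y ∈ A <;> simp [hx, hy]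
  obtain ⟨S, hS1, hS2⟩ := comb_main E {(0, 0)} c hpos low
  have sat : ∀ x ∈ A, ∀ y ∈ Aᶜ, ∃ a ∈ S, ¬ ((⇑T)^[a.2] x ∈ U a.1 ↔ (⇑T)^[a.2] y ∈ U a.1) := by
    intro x hx y hy
    apply Classical.byContradiction
    intro H
    push Not at H
    refine hcon x hx y hy (asym_of_basis _ V hVb x y fun n => ?_)
    obtain ⟨k, hk⟩ := hS1 (n + 1)
    exact ⟨k, fun j hj => H (n + 1, j) (hk j hj)⟩
  obtain ⟨δ, hδ, hδ'⟩ : ∃ δ > 0, ∀ t : ℝ, 0 ≤ t → t < δ →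
      Real.negMulLog t + Real.negMulLog (1 - t) < c / 2 := by
    have ct : Continuous fun t : ℝ => Real.negMulLog t + Real.negMulLog (1 - t) := by
      have := Real.continuous_negMulLog
      fun_prop
    obtain ⟨δ, hδ, h⟩ := Metric.continuous_iff.1 ct 0 (c / 2) (by linarith)
    refine ⟨δ, hδ, fun t h0 ht => ?_⟩
    have := h t (by rw [Real.dist_0_eq_abs, abs_of_nonneg h0]; exact ht)
    rw [Real.dist_eq] at this
    simp only [Real.negMulLog_zero, sub_zero, Real.negMulLog_one, add_zero] at this
    exact (le_abs_self _).trans_lt this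
  obtain ⟨s, B, hs, hB, hBs, hBA⟩ := approx_code μ T hTp.measurable U hU S A hA sat
    (ENNReal.ofReal δ) (by simpa using hδ)
  have a1 := ent_symmDiff_le μ A B hA hB (code U T s) (fm s) hBs
  have a2 := hδ' (μ.real (B ∆ A)) measureReal_nonneg
    ((ENNReal.lt_ofReal_iff_toReal_lt (measure_ne_top _ _)).1 hBA)
  have a3 := hS2 s hs
  have a4 : partEntropy μ (fun x => (decide (x ∈ A), code U T s x)) =
      partEntropy μ (code U T ({(0, 0)} ∪ s)) := ent_congr μ _ _ fun x y => by
    rw [code_union, Prod.mk.injEq, code_eq (s := {(0, 0)})]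
    simp [U0]
  rw [a4] at a1
  linarith
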